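/- arXiv:2301.09259 — 2 statements merged into one kernel-verified Lean document; each statement's English description precedes it below -/
import Mathlib

section
/- Let p be an odd prime and let G = SL₂(ℤ/p) be the special linear group of 2×2 matrices over the field with p elements. Then the third group cohomology of G with coefficients in ℤ, with trivial G-action, vanishes: H³(G; ℤ) = 0. -/
open scoped commutatorElement

section abstractPart

variable {E G A : Type} [Group E] [Group G] [AddCommGroup A]

theorem retract_transfer [DivisibleBy A ℤ] (ι : Multiplicative A →* E)
    (hcen : ∀ a e, ι a * e = e * ι a) (K : Subgroup E) [K.FiniteIndex]
    (hA : ∀ a, ι a ∈ K) (hC : ∀ a, ι a ∈ ⁅K, K⁆ → a = 1) :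
    ∃ τ : E →* Multiplicative A, ∀ a, τ (ι a) = a ^ K.index := by
  let j : Multiplicative A →* K := ι.codRestrict K hA
  let j' : Multiplicative A →* Abelianization K := Abelianization.of.comp j
  have hinj : Function.Injective j' := by
    rw [injective_iff_map_eq_one]
    intro a ha
    apply hC
    have h1 : j a ∈ commutator K := by
      rw [← Abelianization.ker_of]; exact ha
    have h2 := Subgroup.mem_map_of_mem K.subtype h1
    rw [commutator_def, Subgroup.map_commutator] at h2
    simpa [← MonoidHom.range_eq_map, j] using h2
  obtain ⟨h, hh⟩ := (Module.Baer.of_divisible A).extension_property_addMonoidHom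
    (MonoidHom.toAdditive j' : A →+ Additive (Abelianization K)) hinj (AddMonoidHom.id A)
  let φ : K →* Multiplicative A := (AddMonoidHom.toMultiplicative h : Abelianization K →* Multiplicative A).comp Abelianization.of
  have hφ : ∀ a, φ (j a) = a := fun a => DFunLike.congr_fun hh (Multiplicative.toAdd a)
  refine ⟨MonoidHom.transfer φ, fun a => ?_⟩
  rw [MonoidHom.transfer_eq_pow]
  · have : (⟨ι a ^ K.index, K.pow_mem (hA a) _⟩ : K) = j a ^ K.index := rfl
    rw [this, map_pow, hφ]
  · intro k g₀ _
    rw [← map_pow, mul_assoc, hcen]; group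

variable {π : E →* G} {ι : Multiplicative A →* E}

/-- the preimage of a cyclic group is commutative -/
theorem comm_of_cyclic (hπ : Function.Surjective π)
    (hcen : ∀ a e, ι a * e = e * ι a) (hker : ∀ e, π e = 1 → ∃ a, ι a = e)
    (T : Subgroup G) [IsCyclic T] (x y : E) (hx : π x ∈ T) (hy : π y ∈ T) : x * y = y * x := by
  obtain ⟨⟨g, hg⟩, hgen⟩ := IsCyclic.exists_generator (α := T)
  obtain ⟨z, rfl⟩ := hπ g
  have key : ∀ x, π x ∈ T → ∃ (a : _) (n : ℤ), x = ι a * z ^ n := by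
    intro x hx
    obtain ⟨n, hn⟩ := hgen ⟨π x, hx⟩
    obtain ⟨a, ha⟩ := hker (x * (z ^ n)⁻¹) (by
      have : π z ^ n = π x := congrArg Subtype.val hn
      simp [this])
    exact ⟨a, n, by rw [ha]; group⟩
  obtain ⟨a, n, rfl⟩ := key x hx
  obtain ⟨b, m, rfl⟩ := key y hy
  have h1 : Commute (ι a) (ι b) := hcen _ _
  have h2 : ∀ (a : Multiplicative A) (n : ℤ), Commute (ι a) (z ^ n : E) := fun a n => hcen _ _
  have h3 : Commute (z ^ n) (z ^ m) := (Commute.refl z).zpow_zpow n m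
  exact ((h1.mul_right (h2 a m)).mul_left ((h2 b n).symm.mul_right h3))

/-- cyclic subgroup -/
theorem transfer_cyclic [DivisibleBy A ℤ] [Finite G] (hπ : Function.Surjective π)
    (hι : Function.Injective ι)
    (hcen : ∀ a e, ι a * e = e * ι a) (hker : ∀ e, π e = 1 ↔ ∃ a, ι a = e)
    (T : Subgroup G) [IsCyclic T] :
    ∃ τ : E →* Multiplicative A, ∀ a, τ (ι a) = a ^ T.index := by
  have hidx := T.index_comap_of_surjective hπ
  have : (T.comap π).FiniteIndex := ⟨by rw [hidx]; exact Subgroup.FiniteIndex.index_ne_zero⟩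
  rw [← hidx]
  have h1 : ∀ a, π (ι a) = 1 := fun a => (hker _).2 ⟨a, rfl⟩
  refine retract_transfer ι hcen _ (fun a => ?_) (fun a ha => ?_)
  · rw [Subgroup.mem_comap, h1]; exact T.one_mem
  · have : ⁅T.comap π, T.comap π⁆ ≤ ⊥ := by
      rw [Subgroup.commutator_le]
      intro x hx y hy
      rw [Subgroup.mem_bot, commutatorElement_eq_one_iff_mul_comm]
      exact comm_of_cyclic hπ hcen (fun e => (hker e).1) T x y hx hy
    have h2 := this ha
    rw [Subgroup.mem_bot] at h2
    exact hι (by rw [h2, map_one])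

theorem transfer_dicyclic [DivisibleBy A ℤ] [Finite G] (hπ : Function.Surjective π)
    (hι : Function.Injective ι)
    (hcen : ∀ a e, ι a * e = e * ι a) (hker : ∀ e, π e = 1 ↔ ∃ a, ι a = e)
    (T : Subgroup G) [IsCyclic T] (y : G) (hy2 : y * y ∈ T) (hy : y ∉ T)
    (hconj : ∀ t ∈ T, y * t * y⁻¹ = t⁻¹)
    (htor : ∀ t ∈ T, t * t = 1 → t = 1 ∨ t = y * y) :
    ∃ m : ℕ, 2 * m = T.index ∧ ∃ τ : E →* Multiplicative A, ∀ a, τ (ι a) = a ^ m := by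
  have hconj' : ∀ t ∈ T, y⁻¹ * t * y = t⁻¹ := by
    intro t ht
    have := hconj _ (T.inv_mem ht)
    rw [inv_inv] at this
    calc y⁻¹ * t * y = y⁻¹ * (y * t⁻¹ * y⁻¹) * y := by rw [this]
      _ = t⁻¹ := by group
  have hyt : ∀ t ∈ T, y * t = t⁻¹ * y := fun t ht => by rw [← hconj t ht]; group
  have hty : ∀ t ∈ T, t * y = y * t⁻¹ := fun t ht => by rw [← hconj' t ht]; simp [mul_assoc]
  let H : Subgroup G :=
    { carrier := {g | g ∈ T ∨ y * g ∈ T}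
      one_mem' := Or.inl T.one_mem
      mul_mem' := by
        rintro a b (ha | ha) (hb | hb)
        · exact Or.inl (T.mul_mem ha hb)
        · right
          rw [← mul_assoc, hyt a ha, mul_assoc]
          exact T.mul_mem (T.inv_mem ha) hb
        · right
          rw [← mul_assoc]; exact T.mul_mem ha hb
        · left
          have : a * b = (y * y)⁻¹ * ((y * a)⁻¹ * (y * b)) := by
            have h1 := hyt _ ha
            have h2 : y * (y * a) * y⁻¹ = (y * a)⁻¹ := hconj _ ha
            rw [← h2]; group
          rw [this]
          exact T.mul_mem (T.inv_mem hy2) (T.mul_mem (T.inv_mem ha) hb)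
      inv_mem' := by
        rintro a (ha | ha)
        · exact Or.inl (T.inv_mem ha)
        · right
          have : y * a⁻¹ = (y * a) * (y * y) := by
            have h2 : y * (y * a) * y⁻¹ = (y * a)⁻¹ := hconj _ ha
            have h3 : y * (y * a)⁻¹ * y⁻¹ = (y * a)⁻¹⁻¹ := hconj _ (T.inv_mem ha)
            rw [inv_inv] at h3
            rw [← h3]; group
          rw [this]
          exact T.mul_mem ha hy2 }
  have hTH : T ≤ H := fun t ht => Or.inl ht
  have hyH : y ∈ H := Or.inr hy2
  have hrel : T.relIndex H = 2 := by
    rw [Subgroup.relIndex, Subgroup.index_eq_two_iff]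
    refine ⟨⟨y, hyH⟩, ?_⟩
    rintro ⟨b, hb⟩
    simp only [Subgroup.mem_subgroupOf, Subgroup.coe_mul]
    by_cases hbT : b ∈ T
    · exact Or.inr ⟨hbT, fun h => hy ((T.mul_mem_cancel_left hbT).1 h)⟩
    · have hb' : y * b ∈ T := hb.resolve_left hbT
      refine Or.inl ⟨?_, hbT⟩
      have h2 := hconj' _ hb'
      have h3 : b * y = (y * b)⁻¹ := by rw [← h2]; group
      rw [h3]; exact T.inv_mem hb'
  have hidx := H.index_comap_of_surjective hπ
  have : (H.comap π).FiniteIndex := ⟨by rw [hidx]; exact Subgroup.FiniteIndex.index_ne_zero⟩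
  have h1 : ∀ a, π (ι a) = 1 := fun a => (hker _).2 ⟨a, rfl⟩
  refine ⟨H.index, by rw [← hrel]; exact Subgroup.relIndex_mul_index hTH, ?_⟩
  rw [← hidx]
  have hcomm : ∀ x y, π x ∈ T → π y ∈ T → x * y = y * x := 
    comm_of_cyclic hπ hcen (fun e => (hker e).1) T 
  obtain ⟨Y, rfl⟩ := hπ y
  refine retract_transfer ι hcen _ (fun a => ?_) (fun a ha => ?_)
  · rw [Subgroup.mem_comap, h1]; exact H.one_mem
  · have hTY : ∀ x, π x ∈ T → π (Y * x * Y⁻¹) ∈ T := fun x hx => by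
      rw [map_mul, map_mul, map_inv, hconj _ hx]; exact T.inv_mem hx
    have hTY' : ∀ x, π x ∈ T → π (Y⁻¹ * x * Y) ∈ T := fun x hx => by
      rw [map_mul, map_mul, map_inv, hconj' _ hx]; exact T.inv_mem hx
    have hYY : π (Y * Y) ∈ T := by rw [map_mul]; exact hy2
    have hinv : ∀ x, π x ∈ T → π x⁻¹ ∈ T := fun x hx => by rw [map_inv]; exact T.inv_mem hx
    have hmul : ∀ x y, π x ∈ T → π y ∈ T → π (x * y) ∈ T :=
      fun x y hx hy => by rw [map_mul]; exact T.mul_mem hx hy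
    let C : Subgroup E :=
      { carrier := {e | ∃ u, π u ∈ T ∧ e = Y * u * Y⁻¹ * u⁻¹}
        one_mem' := ⟨1, by simp, by simp⟩
        mul_mem' := by
          rintro _ _ ⟨u, hu, rfl⟩ ⟨v, hv, rfl⟩
          refine ⟨u * v, hmul _ _ hu hv, ?_⟩
          have e1 := hcomm (u⁻¹) (Y * v * Y⁻¹ * v⁻¹) (hinv _ hu) (hmul _ _ (hTY _ hv) (hinv _ hv))
          rw [mul_assoc _ u⁻¹, e1]; group
        inv_mem' := by
          rintro _ ⟨u, hu, rfl⟩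
          refine ⟨u⁻¹, hinv _ hu, ?_⟩
          have e1 := hcomm (Y * u⁻¹ * Y⁻¹) (u⁻¹⁻¹) (hTY _ (hinv _ hu)) (hinv _ (hinv _ hu))
          rw [e1]; group }
    have hle : ⁅H.comap π, H.comap π⁆ ≤ C := by
      rw [Subgroup.commutator_le]
      have hform : ∀ x ∈ H.comap π, π x ∈ T ∨ ∃ s, π s ∈ T ∧ x = Y⁻¹ * s := by
        rintro x (hx | hx)
        · exact Or.inl hx
        · exact Or.inr ⟨Y * x, by rw [map_mul]; exact hx, by group⟩
      have mixed : ∀ t s, π t ∈ T → π s ∈ T → ⁅t, Y⁻¹ * s⁆ ∈ C := by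
        intro t s ht hs
        refine ⟨Y⁻¹ * t * Y, hTY' _ ht, ?_⟩
        have e1 := hcomm s t⁻¹ hs (hinv _ ht)
        calc ⁅t, Y⁻¹ * s⁆ = t * Y⁻¹ * (s * t⁻¹) * s⁻¹ * Y := by
              rw [commutatorElement_def]; group
          _ = _ := by rw [e1]; group
      intro x hx y hy
      rcases hform x hx with hx | ⟨s, hs, rfl⟩ <;> rcases hform y hy with hy | ⟨t, ht, rfl⟩
      · rw [commutatorElement_eq_one_iff_mul_comm.2 (hcomm x y hx hy)]; exact C.one_mem
      · exact mixed _ _ hx ht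
      · rw [← commutatorElement_inv]; exact C.inv_mem (mixed _ _ hy hs)
      · rw [← commutatorElement_inv]
        apply C.inv_mem
        refine ⟨Y⁻¹ * (s * t⁻¹) * Y, hTY' _ (hmul _ _ hs (hinv _ ht)), ?_⟩
        have e1 := hcomm (s * t⁻¹) (Y * Y) (hmul _ _ hs (hinv _ ht)) hYY
        have e2 := hcomm (Y⁻¹ * t * Y) (s * t⁻¹) (hTY' _ ht) (hmul _ _ hs (hinv _ ht))
        calc ⁅Y⁻¹ * t, Y⁻¹ * s⁆ = (Y⁻¹ * t * Y) * ((Y * Y)⁻¹ * (s * t⁻¹) * (Y * Y)) * (Y⁻¹ * s⁻¹ * Y) := by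
              rw [commutatorElement_def]; group
          _ = (Y⁻¹ * t * Y) * (s * t⁻¹) * (Y⁻¹ * s⁻¹ * Y) := by
              rw [mul_assoc (Y * Y)⁻¹, e1, inv_mul_cancel_left]
          _ = _ := by rw [e2]; group
    obtain ⟨u, hu, hau⟩ := hle ha
    have h3 := h1 a
    rw [hau, map_mul, map_mul, map_mul, map_inv, map_inv, hconj _ hu, ← mul_inv_rev, inv_eq_one] at h3
    have h4 : ι a = 1 := by
      rw [hau]
      rcases htor _ hu h3 with h5 | h5
      · obtain ⟨b, rfl⟩ := (hker _).1 h5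
        rw [← hcen]; group
      · obtain ⟨b, hb⟩ := (hker (u * (Y * Y)⁻¹)).1 (by
          rw [map_mul, map_inv, h5, map_mul]; group)
        have h6 : u = ι b * (Y * Y) := by rw [hb]; group
        rw [h6, ← mul_assoc Y, ← hcen]; group
    exact hι (by rw [h4, map_one])

end abstractPart

section cocycleExt

/-- The central extension attached to a 2-cocycle. -/
structure CocExt (G A : Type) [Group G] [AddCommGroup A] (f : G → G → A) where
  fst : A
  snd : G

variable {G A : Type} [Group G] [AddCommGroup A] {f : G → G → A}

theorem CocExt.ext' {x y : CocExt G A f} (h1 : x.fst = y.fst) (h2 : x.snd = y.snd) : x = y := by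
  cases x; cases y; simp_all

theorem coc_one_left (hf : ∀ a b c, f b c + f a (b * c) = f (a * b) c + f a b) (g : G) :
    f 1 g = f 1 1 := by
  have := hf 1 1 g
  simp only [one_mul] at this
  exact add_left_cancel this

theorem coc_one_right (hf : ∀ a b c, f b c + f a (b * c) = f (a * b) c + f a b) (g : G) :
    f g 1 = f 1 1 := by
  have := hf g 1 1
  simp only [mul_one] at this
  exact (add_right_cancel this).symm

theorem coc_inv (hf : ∀ a b c, f b c + f a (b * c) = f (a * b) c + f a b) (g : G) :
    f g⁻¹ g = f g g⁻¹ := by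
  have := hf g g⁻¹ g
  simp only [inv_mul_cancel, mul_inv_cancel, coc_one_left hf, coc_one_right hf] at this
  rw [add_comm] at this
  exact add_left_cancel this

/-- Group structure on the extension. -/
@[reducible] def cocGroup (hf : ∀ a b c, f b c + f a (b * c) = f (a * b) c + f a b) :
    Group (CocExt G A f) :=
  letI : Mul (CocExt G A f) := ⟨fun x y => ⟨x.fst + y.fst + f x.snd y.snd, x.snd * y.snd⟩⟩
  letI : One (CocExt G A f) := ⟨⟨-f 1 1, 1⟩⟩
  letI : Inv (CocExt G A f) := ⟨fun x => ⟨-x.fst - f x.snd x.snd⁻¹ - f 1 1, x.snd⁻¹⟩⟩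
  Group.ofLeftAxioms
    (fun x y z => CocExt.ext' (by
      change x.fst + y.fst + f x.snd y.snd + z.fst + f (x.snd * y.snd) z.snd =
        x.fst + (y.fst + z.fst + f y.snd z.snd) + f x.snd (y.snd * z.snd)
      have := hf x.snd y.snd z.snd
      calc _ = x.fst + y.fst + z.fst + (f (x.snd * y.snd) z.snd + f x.snd y.snd) := by abel
        _ = _ := by rw [← this]; abel) (mul_assoc _ _ _))
    (fun x => CocExt.ext' (by
      change -f 1 1 + x.fst + f 1 x.snd = x.fst
      rw [coc_one_left hf x.snd]; abel) (one_mul _))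
    (fun x => CocExt.ext' (by
      change -x.fst - f x.snd x.snd⁻¹ - f 1 1 + x.fst + f x.snd⁻¹ x.snd = - f 1 1
      rw [coc_inv hf]; abel) (inv_mul_cancel _))

theorem split_of_transfers (hf : ∀ a b c, f b c + f a (b * c) = f (a * b) c + f a b)
    (H : ∀ (E : Type) [Group E] (π : E →* G) (ι : Multiplicative A →* E),
      Function.Surjective π → Function.Injective ι → (∀ a e, ι a * e = e * ι a) →
      (∀ e, π e = 1 ↔ ∃ a, ι a = e) → ∃ τ : E →* Multiplicative A, ∀ a, τ (ι a) = a) :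
    ∃ c : G → A, ∀ a b, f a b = c a + c b - c (a * b) := by
  let := cocGroup hf
  have hmul : ∀ x y : CocExt G A f,
    x * y = ⟨x.fst + y.fst + f x.snd y.snd, x.snd * y.snd⟩ := fun _ _ => rfl
  have hone : (1 : CocExt G A f) = ⟨-f 1 1, 1⟩ := rfl
  let π : CocExt G A f →* G := ⟨⟨CocExt.snd, rfl⟩, fun _ _ => rfl⟩
  let ι : Multiplicative A →* CocExt G A f :=
    ⟨⟨fun a => ⟨Multiplicative.toAdd a - f 1 1, 1⟩, CocExt.ext' (zero_sub _) rfl⟩, fun a b =>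
      CocExt.ext' (by
        change a.toAdd + b.toAdd - f 1 1 = a.toAdd - f 1 1 + (b.toAdd - f 1 1) + f 1 1
        abel) (one_mul _).symm⟩
  have hι : ∀ a, ι a = ⟨Multiplicative.toAdd a - f 1 1, 1⟩ := fun _ => rfl
  obtain ⟨τ, hτ⟩ := H (CocExt G A f) π ι (fun g => ⟨⟨0, g⟩, rfl⟩)
    (fun a b h => by
      have h1 := congrArg CocExt.fst h
      exact Multiplicative.toAdd.injective (sub_left_injective h1))
    (fun a e => by
      rw [hι, hmul, hmul]
      refine CocExt.ext' ?_ ?_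
      · change _ + _ + f 1 e.snd = _ + _ + f e.snd 1
        rw [coc_one_left hf e.snd, coc_one_right hf e.snd]; abel
      · simp)
    (fun e => by
      constructor
      · intro h
        exact ⟨Multiplicative.ofAdd (e.fst + f 1 1), CocExt.ext' (add_sub_cancel_right _ _) h.symm⟩
      · rintro ⟨a, rfl⟩
        rfl)
  refine ⟨fun g => (τ ⟨0, g⟩).toAdd, fun a b => ?_⟩
  have h1 : (⟨0, a⟩ : CocExt G A f) * ⟨0, b⟩ = ι (Multiplicative.ofAdd (f a b)) * ⟨0, a * b⟩ := by
    rw [hι, hmul, hmul]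
    refine CocExt.ext' ?_ ?_
    · change 0 + 0 + f a b = f a b - f 1 1 + 0 + f 1 (a * b)
      rw [coc_one_left hf (a * b)]; abel
    · simp
  have h2 := congrArg (fun x => (τ x).toAdd) h1
  simp only [map_mul, toAdd_mul, hτ, toAdd_ofAdd] at h2
  rw [h2]; abel

end cocycleExt
open CategoryTheory
theorem red {G : Type} [Group G] [Finite G]
   (H : ∀ f : G → G → AddCircle (1:ℚ), (∀ a b c, f b c + f a (b * c) = f (a * b) c + f a b) →
     ∃ c : G → AddCircle (1:ℚ), ∀ a b, f a b = c a + c b - c (a * b)) :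
   Subsingleton (groupCohomology (Rep.trivial ℤ G ℤ) 3) := by
  have hex : (groupCohomology.inhomogeneousCochains (Rep.trivial ℤ G ℤ)).ExactAt 3 := by
    rw [HomologicalComplex.exactAt_iff' _ 2 3 4 (by simp) (by simp)]
    rw [ShortComplex.moduleCat_exact_iff]
    intro F hF
    change (groupCohomology.inhomogeneousCochains (Rep.trivial ℤ G ℤ)).d 3 4 F = 0 at hF
    change ∃ K, (groupCohomology.inhomogeneousCochains (Rep.trivial ℤ G ℤ)).d 2 3 K = F
    rw [groupCohomology.inhomogeneousCochains.d_def] at hF ⊢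
    change (Fin 3 → G) → ℤ at F
    have hF' : ∀ a b c d : G, F ![b,c,d] - F ![a*b,c,d] + F ![a,b*c,d] - F ![a,b,c*d] + F ![a,b,c] = 0 := by
      intro a b c d
      have := congrFun hF ![a,b,c,d]
      simp only [inhomogeneousCochains.d_hom_apply] at this
      change F (fun i => ![a, b, c, d] i.succ) + ∑ j : Fin 4, (-1 : ℤ) ^ ((j : ℕ) + 1) •
        F (Fin.contractNth j (· * ·) ![a, b, c, d]) = 0 at this
      rw [Fin.sum_univ_four] at this
      have e (i : Fin 4) : i.contractNth (· * ·) ![a, b, c, d] =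
        ![![a*b, c, d], ![a, b*c, d], ![a, b, c*d], ![a, b, c]] i := by
        fin_cases i <;> funext j <;> fin_cases j <;> rfl
      have e' : (fun i : Fin 3 => ![a, b, c, d] i.succ) = ![b, c, d] := by
        funext j; fin_cases j <;> rfl
      rw [e', e, e, e, e] at this
      simp [pow_succ] at this
      linarith
    suffices h : ∃ K : G → G → ℤ, ∀ a b c, K b c - K (a*b) c + K a (b*c) - K a b = F ![a,b,c] by
      obtain ⟨K, hK⟩ := h
      refine ⟨fun v => K (v 0) (v 1), ?_⟩
      funext v
      rw [inhomogeneousCochains.d_hom_apply]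
      change K (v 1) (v 2) + ∑ j : Fin 3, (-1 : ℤ) ^ ((j : ℕ) + 1) •
        K (Fin.contractNth j (· * ·) v 0) (Fin.contractNth j (· * ·) v 1) = F v
      have ev : v = ![v 0, v 1, v 2] := by funext j; fin_cases j <;> rfl
      have hv := hK (v 0) (v 1) (v 2)
      rw [← ev] at hv
      rw [← hv, Fin.sum_univ_three]
      have e1 : Fin.contractNth (0 : Fin 3) (· * ·) v = ![v 0 * v 1, v 2] := by
        funext j; fin_cases j <;> rfl
      have e2 : Fin.contractNth (1 : Fin 3) (· * ·) v = ![v 0, v 1 * v 2] := by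
        funext j; fin_cases j <;> rfl
      have e3 : Fin.contractNth (2 : Fin 3) (· * ·) v = ![v 0, v 1] := by
        funext j; fin_cases j <;> rfl
      rw [e1, e2, e3]
      simp [pow_succ]
      ring
    have := Fintype.ofFinite G
    let S : G → G → ℤ := fun a b => ∑ x, F ![a, b, x]
    have hS : ∀ a b c, S b c - S (a * b) c + S a (b * c) - S a b + Fintype.card G * F ![a, b, c] = 0 := by
      intro a b c
      have h0 : ∑ d, F ![a, b, c * d] = S a b :=
        Fintype.sum_equiv (Equiv.mulLeft c) _ _ (fun _ => rfl)
      have h1 := Finset.sum_eq_zero (s := Finset.univ) (fun d _ => hF' a b c d)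
      simp only [Finset.sum_add_distrib, Finset.sum_sub_distrib, h0, Finset.sum_const,
        Finset.card_univ, nsmul_eq_mul] at h1
      exact h1
    have hn : (Fintype.card G : ℚ) ≠ 0 := by exact_mod_cast Fintype.card_ne_zero
    let h : G → G → ℚ := fun a b => - (S a b : ℚ) / Fintype.card G
    have hh : ∀ a b c, h b c - h (a * b) c + h a (b * c) - h a b = F ![a, b, c] := by
      intro a b c
      have h1 : (S b c - S (a * b) c + S a (b * c) - S a b + Fintype.card G * F ![a, b, c] : ℚ) = 0 := by
        exact_mod_cast hS a b c
      simp only [h]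
      field_simp
      linarith
    have hz : ∀ z : ℤ, ((z : ℚ) : AddCircle (1 : ℚ)) = 0 := fun z =>
      (AddCircle.coe_eq_zero_iff 1).2 ⟨z, by simp⟩
    obtain ⟨c, hc⟩ := H (fun a b => (h a b : AddCircle (1 : ℚ))) (by
      intro a b c
      have h1 := congrArg (fun q : ℚ => (q : AddCircle (1 : ℚ))) (hh a b c)
      simp only [hz, AddCircle.coe_sub, AddCircle.coe_add] at h1
      rw [← sub_eq_zero, ← h1]
      abel)
    choose c' hc' using fun g => QuotientAddGroup.mk_surjective (c g)
    have hk : ∀ a b, ∃ z : ℤ, (z : ℚ) = h a b - (c' a + c' b - c' (a * b)) := by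
      intro a b
      have h1 : ((h a b - (c' a + c' b - c' (a * b)) : ℚ) : AddCircle (1 : ℚ)) = 0 := by
        simp only [AddCircle.coe_sub, AddCircle.coe_add]
        rw [hc a b, ← hc' a, ← hc' b, ← hc' (a * b)]
        exact sub_self _
      obtain ⟨z, hz⟩ := (AddCircle.coe_eq_zero_iff 1).1 h1
      exact ⟨z, by rw [← hz]; simp⟩
    choose K hK using hk
    refine ⟨K, fun a b c => ?_⟩
    have h1 := hh a b c
    have : (K b c - K (a * b) c + K a (b * c) - K a b : ℚ) = F ![a, b, c] := by
      rw [hK, hK, hK, hK, ← h1, mul_assoc]; ring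
    exact_mod_cast this
  have := hex.isZero_homology
  exact ModuleCat.subsingleton_of_isZero this

section slPart
open Matrix

variable (p : ℕ) [Fact p.Prime]

abbrev SLp := Matrix.SpecialLinearGroup (Fin 2) (ZMod p)

theorem card_SLp : Nat.card (SLp p) = p * (p ^ 2 - 1) := by
  have hp : 2 ≤ p := (Fact.out : p.Prime).two_le
  have h1 := Matrix.card_GL_field (𝔽 := ZMod p) 2
  simp only [Fin.prod_univ_two, ZMod.card] at h1
  let d : GL (Fin 2) (ZMod p) →* (ZMod p)ˣ := Matrix.GeneralLinearGroup.det
  have hd : Function.Surjective d := by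
    intro u
    refine ⟨Matrix.GeneralLinearGroup.mkOfDetNeZero !![(u : ZMod p), 0; 0, 1] (by simp), ?_⟩
    ext
    simp [d, Matrix.GeneralLinearGroup.mkOfDetNeZero]
  have h2 : Nat.card d.ker = Nat.card (SLp p) := by
    refine Nat.card_congr ⟨fun x => ⟨x.1.1, by
        have := congrArg Units.val x.2
        simpa [d] using this⟩,
      fun x => ⟨Matrix.SpecialLinearGroup.toGL x, by
        rw [MonoidHom.mem_ker]; ext; simp [d]⟩, fun x => ?_, fun x => ?_⟩
    · ext; rfl
    · ext; rfl
  have h3 := Subgroup.card_eq_card_quotient_mul_card_subgroup d.ker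
  rw [h1, Nat.card_congr (QuotientGroup.quotientKerEquivOfSurjective d hd).toEquiv, h2,
    Nat.card_eq_fintype_card, ZMod.card_units] at h3
  have hpp : 0 < p - 1 := by omega
  apply Nat.eq_of_mul_eq_mul_left hpp
  rw [← h3]
  have : p ^ 2 - p ^ 1 = (p - 1) * p := by rw [Nat.sub_mul]; ring_nf
  simp only [Fin.val_zero, Fin.val_one, pow_zero, this] 
  ring

theorem sl_invol (hp : p ≠ 2) (t : SLp p) (h : t * t = 1) : t = 1 ∨ t = -1 := by
  have h2 : (2 : ZMod p) ≠ 0 := by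
    intro h
    have : ((2 : ℕ) : ZMod p) = 0 := by exact_mod_cast h
    rw [ZMod.natCast_eq_zero_iff] at this
    exact hp ((Nat.prime_dvd_prime_iff_eq Fact.out Nat.prime_two).1 this)
  have hinv : t = t⁻¹ := eq_inv_of_mul_eq_one_left h
  have hm := congrArg Subtype.val hinv
  rw [Matrix.SpecialLinearGroup.coe_inv, Matrix.adjugate_fin_two] at hm
  have e01 := congrFun (congrFun hm 0) 1
  have e10 := congrFun (congrFun hm 1) 0
  have e00 := congrFun (congrFun hm 0) 0
  simp at e01 e10 e00
  have z01 : t.1 0 1 = 0 := by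
    have : 2 * t.1 0 1 = 0 := by linear_combination e01
    simpa [h2] using this
  have z10 : t.1 1 0 = 0 := by
    have : 2 * t.1 1 0 = 0 := by linear_combination e10
    simpa [h2] using this
  have hdet := t.2
  rw [Matrix.det_fin_two, z01, ← e00] at hdet
  have : t.1 0 0 * t.1 0 0 = 1 := by linear_combination hdet
  rcases mul_self_eq_one_iff.1 this with h | h
  · left
    ext i j
    fin_cases i <;> fin_cases j <;> simp [z01, z10, h, ← e00]
  · right
    ext i j
    fin_cases i <;> fin_cases j <;> simp [z01, z10, h, ← e00]

variable {p} in
/-- a matrix in SL2 from its entries -/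
def mk4 (a b c d : ZMod p) (h : a * d - b * c = 1) : SLp p :=
  ⟨!![a, b; c, d], by rw [Matrix.det_fin_two_of, h]⟩

variable {p} in
theorem mk4_congr {a b c d a' b' c' d' : ZMod p} {h : a * d - b * c = 1}
    {h' : a' * d' - b' * c' = 1} (h1 : a = a') (h2 : b = b') (h3 : c = c') (h4 : d = d') :
    mk4 a b c d h = mk4 a' b' c' d' h' := by
  subst h1 h2 h3 h4; rfl

variable {p} in
theorem mk4_mul {a b c d a' b' c' d' : ZMod p} {h : a * d - b * c = 1}
    {h' : a' * d' - b' * c' = 1} :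
    mk4 a b c d h * mk4 a' b' c' d' h' =
      mk4 (a * a' + b * c') (a * b' + b * d') (c * a' + d * c') (c * b' + d * d')
        (by linear_combination (a' * d' - b' * c') * h + h') := by
  apply Subtype.ext
  rw [Matrix.SpecialLinearGroup.coe_mul]
  simp only [mk4, Matrix.mul_fin_two]

theorem mk4_one : (1 : SLp p) = mk4 1 0 0 1 (by ring) := by
  apply Subtype.ext
  simp only [mk4, Matrix.SpecialLinearGroup.coe_one, Matrix.one_fin_two]

theorem mk4_neg_one : (-1 : SLp p) = mk4 (-1) 0 0 (-1) (by ring) := by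
  ext i j
  fin_cases i <;> fin_cases j <;> simp [mk4]

/-- unipotent subgroup -/
theorem exists_unipotent : ∃ U : Subgroup (SLp p), IsCyclic U ∧ Nat.card U = p := by
  let ψ : Multiplicative (ZMod p) →* SLp p :=
    { toFun := fun a => mk4 1 a.toAdd 0 1 (by ring)
      map_one' := (mk4_one p).symm
      map_mul' := fun a b => by
        rw [mk4_mul]
        apply mk4_congr <;> simp [add_comm] }
  have hψ : Function.Injective ψ := by
    intro a b h
    exact congrFun (congrFun (congrArg Subtype.val h) 0) 1
  refine ⟨ψ.range, isCyclic_of_surjective ψ.rangeRestrict ψ.rangeRestrict_surjective, ?_⟩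
  rw [← Nat.card_congr (MonoidHom.ofInjective hψ).toEquiv]
  simp

theorem exists_split : ∃ (T : Subgroup (SLp p)) (y : SLp p), IsCyclic T ∧
    Nat.card T = p - 1 ∧ y * y = -1 ∧ y * y ∈ T ∧ ∀ t ∈ T, y * t * y⁻¹ = t⁻¹ := by
  let ψ : (ZMod p)ˣ →* SLp p :=
    { toFun := fun a => mk4 a 0 0 ((a⁻¹ : (ZMod p)ˣ) : ZMod p) (by rw [Units.mul_inv]; ring)
      map_one' := by
        rw [mk4_one]; apply mk4_congr <;> simp
      map_mul' := fun a b => by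
        rw [mk4_mul]; apply mk4_congr
        · rw [Units.val_mul]; ring
        · ring
        · ring
        · rw [mul_inv, Units.val_mul]; ring }
  have hψa : ∀ a, ψ a = mk4 a 0 0 ((a⁻¹ : (ZMod p)ˣ) : ZMod p) (by rw [Units.mul_inv]; ring) :=
    fun _ => rfl
  have hψ : Function.Injective ψ := by
    intro a b h
    exact Units.ext (congrFun (congrFun (congrArg Subtype.val h) 0) 0)
  let y : SLp p := mk4 0 1 (-1) 0 (by ring)
  have hyy : y * y = -1 := by
    rw [mk4_neg_one]; simp only [y, mk4_mul]; apply mk4_congr <;> ring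
  refine ⟨ψ.range, y, isCyclic_of_surjective ψ.rangeRestrict ψ.rangeRestrict_surjective,
    ?_, hyy, ?_, ?_⟩
  · rw [← Nat.card_congr (MonoidHom.ofInjective hψ).toEquiv, Nat.card_eq_fintype_card,
      ZMod.card_units]
  · rw [hyy]
    refine ⟨-1, ?_⟩
    rw [mk4_neg_one, hψa]
    apply mk4_congr <;> simp
  · rintro _ ⟨a, rfl⟩
    rw [mul_inv_eq_iff_eq_mul, ← map_inv, hψa, hψa]
    simp only [y]
    rw [mk4_mul, mk4_mul]
    apply mk4_congr <;> first | (rw [inv_inv]; ring) | ring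

/-- the quadratic extension -/
abbrev QK (ε : ZMod p) := QuadraticAlgebra (ZMod p) ε 0

theorem norm_surj (hp : p ≠ 2) (ε : ZMod p) (hε : ε ≠ 0) (c : ZMod p) :
    ∃ a b : ZMod p, a * a - ε * (b * b) = c := by
  open Polynomial in
  obtain ⟨a, b, h⟩ := FiniteField.exists_root_sum_quadratic (R := ZMod p)
    (f := X ^ 2 - C c) (g := C (-ε) * X ^ 2) (degree_X_pow_sub_C (by decide) _)
    (degree_C_mul_X_pow 2 (by simpa using hε)) 
    (by rw [ZMod.card]; exact Nat.odd_iff.1 ((Fact.out : p.Prime).odd_of_ne_two hp))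
  simp at h
  exact ⟨a, b, by linear_combination h⟩

theorem exists_nonsplit (hp : p ≠ 2) : ∃ (T : Subgroup (SLp p)) (y : SLp p), IsCyclic T ∧
    Nat.card T = p + 1 ∧ y * y = -1 ∧ y * y ∈ T ∧ ∀ t ∈ T, y * t * y⁻¹ = t⁻¹ := by
  obtain ⟨ε, hε⟩ := FiniteField.exists_nonsquare (F := ZMod p) (by rwa [ZMod.ringChar_zmod_n])
  have hε0 : ε ≠ 0 := by rintro rfl; exact hε ⟨0, by simp⟩
  have : Fact (∀ r : ZMod p, r ^ 2 ≠ ε + 0 * r) := ⟨fun r h => hε ⟨r, by linear_combination -h⟩⟩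
  let e : (QK p ε) ≃ ZMod p × ZMod p := ⟨fun z => (z.re, z.im), fun z => ⟨z.1, z.2⟩, fun _ => rfl, fun _ => rfl⟩
  have : Finite (QK p ε) := Finite.of_equiv _ e.symm
  have hK : Nat.card (QK p ε) = p * p := by rw [Nat.card_congr e]; simp
  let N : (QK p ε)ˣ →* (ZMod p)ˣ := Units.map QuadraticAlgebra.norm
  have hN : Function.Surjective N := by
    intro u
    obtain ⟨a, b, h⟩ := norm_surj p hp ε hε0 u
    let z : (QK p ε) := ⟨a, b⟩
    have hz : QuadraticAlgebra.norm z = u := by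
      rw [← h, QuadraticAlgebra.norm_def]; simp [z]; ring
    have : z ≠ 0 := by
      intro h0
      rw [h0, QuadraticAlgebra.norm_zero] at hz
      exact u.ne_zero hz.symm
    exact ⟨Units.mk0 z this, Units.ext hz⟩
  have hcard : Nat.card N.ker = p + 1 := by
    have h3 := Subgroup.card_eq_card_quotient_mul_card_subgroup N.ker
    rw [Nat.card_congr (QuotientGroup.quotientKerEquivOfSurjective N hN).toEquiv, 
      Nat.card_units, hK, Nat.card_eq_fintype_card, ZMod.card_units] at h3
    have hp2 : 2 ≤ p := (Fact.out : p.Prime).two_le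
    have hpp : 0 < p - 1 := by omega
    apply Nat.eq_of_mul_eq_mul_left hpp
    rw [← h3]
    obtain ⟨q, rfl⟩ : ∃ q, p = q + 1 := ⟨p - 1, by omega⟩
    simp only [Nat.add_sub_cancel]
    have : (q + 1) * (q + 1) = q * (q + 1 + 1) + 1 := by ring
    rw [this, Nat.add_sub_cancel]
  have hnorm : ∀ z : N.ker, (z.1.1.re * z.1.1.re - ε * (z.1.1.im * z.1.1.im)) = 1 := by
    intro z
    have := congrArg Units.val z.2
    change QuadraticAlgebra.norm z.1.1 = 1 at this
    rw [← this, QuadraticAlgebra.norm_def]; simp; ring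
  let ψ : N.ker →* SLp p :=
    { toFun := fun z => mk4 z.1.1.re (ε * z.1.1.im) z.1.1.im z.1.1.re (by
        rw [← hnorm z]; ring)
      map_one' := by
        rw [mk4_one]; exact mk4_congr rfl (mul_zero _) rfl rfl
      map_mul' := fun a b => by
        rw [mk4_mul]; apply mk4_congr <;> simp <;> ring }
  have hψa : ∀ z, ψ z = mk4 z.1.1.re (ε * z.1.1.im) z.1.1.im z.1.1.re
      (by rw [← hnorm z]; ring) := fun _ => rfl
  have hψ : Function.Injective ψ := by
    intro a b h
    exact Subtype.ext (Units.ext (QuadraticAlgebra.ext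
      (congrFun (congrFun (congrArg Subtype.val h) 0) 0)
      (congrFun (congrFun (congrArg Subtype.val h) 1) 0)))
  obtain ⟨u, v, huv⟩ := norm_surj p hp ε hε0 (-1)
  let y : SLp p := mk4 u (-ε * v) v (-u) (by linear_combination -huv)
  have hyy : y * y = -1 := by
    rw [mk4_neg_one]; simp only [y, mk4_mul]
    apply mk4_congr
    · linear_combination huv
    · ring
    · ring
    · linear_combination huv
  have hcyc : IsCyclic N.ker := inferInstance
  refine ⟨ψ.range, y, isCyclic_of_surjective ψ.rangeRestrict ψ.rangeRestrict_surjective,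
    ?_, hyy, ?_, ?_⟩
  · rw [← Nat.card_congr (MonoidHom.ofInjective hψ).toEquiv, hcard]
  · rw [hyy]
    refine ⟨⟨-1, ?_⟩, ?_⟩
    · rw [MonoidHom.mem_ker]; ext; simp [N]
    rw [mk4_neg_one, hψa]
    apply mk4_congr <;> simp <;> first | rfl | exact Or.inr rfl
  · rintro _ ⟨a, rfl⟩
    have hz := hnorm a
    have hi : (ψ a)⁻¹ = mk4 a.1.1.re (-(ε * a.1.1.im)) (-a.1.1.im) a.1.1.re
        (by linear_combination hz) := by
      rw [inv_eq_iff_mul_eq_one, mk4_one]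
      rw [hψa, mk4_mul]
      apply mk4_congr
      · linear_combination hz
      · ring
      · ring
      · linear_combination hz
    rw [mul_inv_eq_iff_eq_mul, hi, hψa]
    simp only [y]
    rw [mk4_mul, mk4_mul]
    apply mk4_congr <;> ring

end slPart

theorem stmt3 (p : ℕ) [Fact p.Prime] (hp : Odd p) :
    Subsingleton
      (groupCohomology (Rep.trivial ℤ (Matrix.SpecialLinearGroup (Fin 2) (ZMod p)) ℤ) 3) := by
  have hp2 : p ≠ 2 := by rintro rfl; exact absurd hp (by decide)
  have hp3 : 2 ≤ p := (Fact.out : p.Prime).two_le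
  apply red
  intro f hf
  apply split_of_transfers hf
  intro E _ π ι hπ hι hcen hker
  have hneg : (-1 : SLp p) ≠ 1 := by
    intro h
    have h1 : (-1 : ZMod p) = 1 := by
      rw [mk4_neg_one, mk4_one] at h
      exact congrFun (congrFun (congrArg Subtype.val h) 0) 0
    have : Fact (2 < p) := ⟨by omega⟩
    exact ZMod.neg_one_ne_one h1
  have dic : ∀ (T : Subgroup (SLp p)) (y : SLp p), IsCyclic T → y * y = -1 → y * y ∈ T →
      (∀ t ∈ T, y * t * y⁻¹ = t⁻¹) → ∃ m : ℕ, 2 * m = T.index ∧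
        ∃ τ : E →* Multiplicative (AddCircle (1 : ℚ)), ∀ a, τ (ι a) = a ^ m := by
    intro T y hT hy hyT hc
    refine transfer_dicyclic hπ hι hcen hker T y hyT (fun h => ?_) hc (fun t _ h => ?_)
    · have h1 := hc y h
      rw [mul_inv_cancel_right, eq_inv_iff_mul_eq_one, hy] at h1
      exact hneg h1
    · rw [hy]; exact sl_invol p hp2 t h
  obtain ⟨U, hU, hUc⟩ := exists_unipotent p
  obtain ⟨τ₁, h₁⟩ := transfer_cyclic hπ hι hcen hker U
  obtain ⟨T, y, hT, hTc, hy, hyT, hc⟩ := exists_split p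
  obtain ⟨m, hm, τ₂, h₂⟩ := dic T y hT hy hyT hc
  obtain ⟨T', y', hT', hTc', hy', hyT', hc'⟩ := exists_nonsplit p hp2
  obtain ⟨n, hn, τ₃, h₃⟩ := dic T' y' hT' hy' hyT' hc'
  have i1 := U.card_mul_index
  have i2 := T.card_mul_index
  have i3 := T'.card_mul_index
  rw [hUc, card_SLp] at i1
  rw [hTc, card_SLp, ← hm] at i2
  rw [hTc', card_SLp, ← hn] at i3
  obtain ⟨q, rfl⟩ : ∃ q, p = q + 1 := ⟨p - 1, by omega⟩
  have e : (q + 1) ^ 2 - 1 = q * (q + 2) := by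
    rw [show (q + 1) ^ 2 = q * (q + 2) + 1 by ring]; rfl
  rw [e] at i1 i2 i3
  simp only [Nat.add_sub_cancel] at i2
  have j1 : U.index = q * (q + 2) := Nat.eq_of_mul_eq_mul_left (by omega) i1
  have j2 : 2 * m = (q + 1) * (q + 2) := by
    apply Nat.eq_of_mul_eq_mul_left (show 0 < q by omega); rw [i2]; ring
  have j3 : 2 * n = (q + 1) * q := by
    apply Nat.eq_of_mul_eq_mul_left (show 0 < q + 1 + 1 by omega); rw [i3]; ring
  have j4 : m = n + (q + 1) := by nlinarith
  refine ⟨(τ₂ * τ₃⁻¹) ^ (q + 1) * τ₁⁻¹, fun a => ?_⟩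
  simp only [MonoidHom.mul_apply, MonoidHom.pow_apply, MonoidHom.inv_apply, h₁, h₂, h₃]
  rw [j4, pow_add a n, mul_comm (a ^ n), mul_inv_cancel_right, ← pow_mul, j1,
    show (q + 1) * (q + 1) = 1 + q * (q + 2) by ring, pow_add a 1, mul_inv_cancel_right, pow_one]
end

section
/- Let p be any prime and let P be a subgroup of 𝐒 that is conjugate in U(p) to Γ, i.e. there exists u ∈ U(p) with uΓu⁻¹ = P. Then there exists g ∈ U(p) with gPg⁻¹ = Γ and g𝐒g⁻¹ = 𝐒; that is, the chain of subgroups (P ⊂ 𝐒) is U(p)-conjugate to the chain (Γ ⊂ 𝐒). -/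
open Matrix

noncomputable def zeta (p : ℕ) : ℂ := Complex.exp (2 * Real.pi * Complex.I / p)

noncomputable def Amat (p : ℕ) [NeZero p] : Matrix (ZMod p) (ZMod p) ℂ :=
  Matrix.diagonal fun i => zeta p ^ i.val

def Bmat (p : ℕ) [NeZero p] : Matrix (ZMod p) (ZMod p) ℂ :=
  Matrix.of fun i j => if j = i + 1 then 1 else 0

def tauMat (p : ℕ) [NeZero p] : Matrix (ZMod p) (ZMod p) ℂ :=
  Matrix.of fun i j => if j = -i then 1 else 0

abbrev UG (p : ℕ) [NeZero p] : Type := Matrix.unitaryGroup (ZMod p) ℂ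

/-- The central subgroup `S¹` of unitary scalar matrices. -/
def scalarSubgroup (p : ℕ) [NeZero p] : Subgroup (UG p) where
  carrier := {g | ∃ z : ℂ, (g : Matrix (ZMod p) (ZMod p) ℂ) = z • (1 : Matrix (ZMod p) (ZMod p) ℂ)}
  one_mem' := ⟨1, by simp⟩
  mul_mem' := by
    rintro g h ⟨z, hz⟩ ⟨w, hw⟩
    refine ⟨z * w, ?_⟩
    show ((g * h : UG p) : Matrix (ZMod p) (ZMod p) ℂ) = (z * w) • 1
    rw [Matrix.UnitaryGroup.mul_val, hz, hw, smul_mul_assoc, mul_smul_comm, one_mul, smul_smul]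
  inv_mem' := by
    rintro g ⟨z, hz⟩
    refine ⟨star z, ?_⟩
    show ((g⁻¹ : UG p) : Matrix (ZMod p) (ZMod p) ℂ) = star z • 1
    rw [Matrix.UnitaryGroup.inv_val, hz, star_smul, star_one]

/-- The subgroup `Γ` of `U(p)` generated by `A`, `B`, and the scalar matrices. -/
def Gamma (p : ℕ) [NeZero p] (a b : UG p) : Subgroup (UG p) :=
  Subgroup.closure ({a, b} ∪ (scalarSubgroup p : Set (UG p)))

/-- The maximal torus `𝐓` of diagonal unitary matrices. -/
def Tsub (p : ℕ) [NeZero p] : Subgroup (UG p) where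
  carrier := {g | ∃ f : ZMod p → ℂ, (g : Matrix (ZMod p) (ZMod p) ℂ) = Matrix.diagonal f}
  one_mem' := ⟨fun _ => 1, by rw [Matrix.UnitaryGroup.one_val, Matrix.diagonal_one]⟩
  mul_mem' := by
    rintro g h ⟨f, hf⟩ ⟨f', hf'⟩
    refine ⟨f * f', ?_⟩
    show ((g * h : UG p) : Matrix (ZMod p) (ZMod p) ℂ) = _
    rw [Matrix.UnitaryGroup.mul_val, hf, hf', Matrix.diagonal_mul_diagonal]; rfl
  inv_mem' := by
    rintro g ⟨f, hf⟩
    refine ⟨star f, ?_⟩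
    show ((g⁻¹ : UG p) : Matrix (ZMod p) (ZMod p) ℂ) = _
    rw [Matrix.UnitaryGroup.inv_val, hf, Matrix.star_eq_conjTranspose,
      Matrix.diagonal_conjTranspose]

/-- The maximal `p`-toral subgroup `𝐒` of `U(p)`, generated by `𝐓` and `B`. -/
def Sbold (p : ℕ) [NeZero p] (b : UG p) : Subgroup (UG p) :=
  Tsub p ⊔ Subgroup.closure {b}


namespace Stmt17

variable {p : ℕ} [Fact p.Prime]

/-- `zeta ^ i.val` as an additive character. -/
noncomputable def ch (p : ℕ) [Fact p.Prime] (i : ZMod p) : ℂ := zeta p ^ i.val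

lemma ch_eq (i : ZMod p) : ch p i = ZMod.stdAddChar i := by
  conv_rhs => rw [← ZMod.natCast_zmod_val i]
  have := ZMod.stdAddChar_coe (N := p) (i.val : ℤ)
  rw [Int.cast_natCast] at this
  rw [this, ch, zeta, ← Complex.exp_nat_mul]
  congr 1
  push_cast
  ring

lemma ch_add (i j : ZMod p) : ch p (i + j) = ch p i * ch p j := by
  simp only [ch_eq, AddChar.map_add_eq_mul]

lemma ch_zero : ch p 0 = 1 := by simp [ch_eq]

lemma ch_ne (i : ZMod p) : ch p i ≠ 0 := by
  intro h
  have := ch_add i (-i)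
  rw [h, add_neg_cancel, ch_zero] at this
  simp at this

lemma ch_inj {i j : ZMod p} (h : ch p i = ch p j) : i = j := by
  rw [ch_eq, ch_eq] at h
  exact ZMod.injective_stdAddChar h

lemma ch_pow (i : ZMod p) (n : ℕ) : ch p i ^ n = ch p (n * i) := by
  induction n with
  | zero => simp [ch_zero]
  | succ n ih => rw [pow_succ, ih, ← ch_add]; congr 1; push_cast; ring

lemma ch_surj {z : ℂ} (hz : z ^ p = 1) : ∃ m : ℕ, z = ch p (m : ZMod p) := by
  have hp : p ≠ 0 := (Fact.out : p.Prime).ne_zero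
  have hprim : IsPrimitiveRoot (zeta p) p := Complex.isPrimitiveRoot_exp p hp
  haveI : NeZero p := ⟨hp⟩
  obtain ⟨i, hi, rfl⟩ := hprim.eq_pow_of_pow_eq_one hz
  exact ⟨i, by rw [ch, ZMod.val_natCast_of_lt hi]⟩

/-- The support of `g` is the shift by `k`. -/
def Sh (k : ZMod p) (g : UG p) : Prop :=
  ∀ i j, (g : Matrix (ZMod p) (ZMod p) ℂ) i j ≠ 0 → j = i + k

lemma sh_mul {k l : ZMod p} {g h : UG p} (hg : Sh k g) (hh : Sh l h) : Sh (k + l) (g * h) := by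
  intro i j hij
  rw [Matrix.UnitaryGroup.mul_val, Matrix.mul_apply] at hij
  obtain ⟨m, -, hm⟩ := Finset.exists_ne_zero_of_sum_ne_zero hij
  rw [hh m j (right_ne_zero_of_mul hm), hg i m (left_ne_zero_of_mul hm), add_assoc]

lemma sh_one : Sh (0 : ZMod p) (1 : UG p) := by
  intro i j hij
  rw [Matrix.UnitaryGroup.one_val] at hij
  by_contra h
  rw [add_zero] at h
  exact hij (Matrix.one_apply_ne (Ne.symm h))

lemma sh_inv {k : ZMod p} {g : UG p} (hg : Sh k g) : Sh (-k) g⁻¹ := by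
  intro i j hij
  rw [Matrix.UnitaryGroup.inv_val, Matrix.star_apply] at hij
  rw [hg j i (star_ne_zero.mp hij)]
  ring

lemma sh_pow {k : ZMod p} {g : UG p} (hg : Sh k g) (n : ℕ) : Sh ((n : ZMod p) * k) (g ^ n) := by
  induction n with
  | zero => simpa using sh_one
  | succ n ih =>
    rw [pow_succ]
    have := sh_mul ih hg
    convert this using 1
    push_cast; ring

lemma mem_T {g : UG p} : g ∈ Tsub p ↔ Sh 0 g := by
  constructor
  · rintro ⟨f, hf⟩ i j hij
    rw [hf] at hij
    by_contra h
    rw [add_zero] at h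
    exact hij (Matrix.diagonal_apply_ne _ (Ne.symm h))
  · intro h
    refine ⟨fun i => g.1 i i, ?_⟩
    ext i j
    by_cases hij : i = j
    · subst hij; simp
    · rw [Matrix.diagonal_apply_ne _ hij]
      by_contra h0
      exact hij (by rw [h i j h0, add_zero])

lemma sh_b {b : UG p} (hb : (b : Matrix (ZMod p) (ZMod p) ℂ) = Bmat p) : Sh 1 b := by
  intro i j hij
  rw [hb] at hij
  by_contra h
  simp [Bmat, h] at hij

/-- The subgroup of shifts. -/
def Ssub (p : ℕ) [Fact p.Prime] : Subgroup (UG p) where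
  carrier := {g | ∃ k, Sh k g}
  one_mem' := ⟨0, sh_one⟩
  mul_mem' := by
    rintro g h ⟨k, hk⟩ ⟨l, hl⟩
    exact ⟨_, sh_mul hk hl⟩
  inv_mem' := by
    rintro g ⟨k, hk⟩
    exact ⟨_, sh_inv hk⟩

lemma S_le {b : UG p} (hb : (b : Matrix (ZMod p) (ZMod p) ℂ) = Bmat p) {g : UG p}
    (h : g ∈ Sbold p b) : ∃ k, Sh k g := by
  have : Sbold p b ≤ Ssub p := by
    refine sup_le ?_ ?_
    · intro g hg
      exact ⟨0, mem_T.mp hg⟩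
    · rw [Subgroup.closure_le, Set.singleton_subset_iff]
      exact ⟨1, sh_b hb⟩
  exact this h

lemma scalar_comm {z : UG p} (hz : z ∈ scalarSubgroup p) (g : UG p) : z * g = g * z := by
  obtain ⟨c, hc⟩ := hz
  apply Subtype.ext
  rw [Matrix.UnitaryGroup.mul_val, Matrix.UnitaryGroup.mul_val, hc]
  simp

lemma scalar_normal : (scalarSubgroup p).Normal := by
  constructor
  intro n hn g
  rw [← scalar_comm hn g, mul_inv_cancel_right]
  exact hn

lemma comm_val {g h : UG p} (H : g * h * (h * g)⁻¹ ∈ scalarSubgroup p) :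
    ∃ c : ℂ, (g : Matrix (ZMod p) (ZMod p) ℂ) * h.1 = c • (h.1 * g.1) := by
  obtain ⟨c, hc⟩ := H
  refine ⟨c, ?_⟩
  have : g * h = (g * h * (h * g)⁻¹) * (h * g) := by group
  have := congrArg Subtype.val this
  rw [Matrix.UnitaryGroup.mul_val, Matrix.UnitaryGroup.mul_val _ (h * g), hc] at this
  simpa using this

lemma a_pow {a : UG p} (ha : (a : Matrix (ZMod p) (ZMod p) ℂ) = Amat p) (m : ℕ) :
    ((a ^ m : UG p) : Matrix (ZMod p) (ZMod p) ℂ) = diagonal fun i => ch p (m * i) := by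
  have : ((a ^ m : UG p) : Matrix (ZMod p) (ZMod p) ℂ) = a.1 ^ m := rfl
  rw [this, ha, Amat, Matrix.diagonal_pow]
  congr 1
  ext i
  rw [← ch_pow]; rfl

lemma a_pow_congr {a : UG p} (ha : (a : Matrix (ZMod p) (ZMod p) ℂ) = Amat p) {m n : ℕ}
    (h : (m : ZMod p) = n) : a ^ m = a ^ n := by
  apply Subtype.ext
  rw [a_pow ha, a_pow ha, h]

lemma scalar_of_smul {g h : UG p} {c : ℂ} (H : g.1 = c • h.1) :
    g * h⁻¹ ∈ scalarSubgroup p := by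
  refine ⟨c, ?_⟩
  rw [Matrix.UnitaryGroup.mul_val, H, smul_mul_assoc, ← Matrix.UnitaryGroup.mul_val,
    mul_inv_cancel]
  rfl

lemma diag_ne {t : UG p} {k : ZMod p} (ht : Sh k t) (i : ZMod p) : star (t.1 i (i + k)) * t.1 i (i + k) = 1 := by
  have h : (t * t⁻¹).1 i i = 1 := by rw [mul_inv_cancel]; simp
  rw [Matrix.UnitaryGroup.mul_val, Matrix.mul_apply, Finset.sum_eq_single (i + k)] at h
  · rw [Matrix.UnitaryGroup.inv_val, Matrix.star_apply] at h
    rw [mul_comm]; exact h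
  · intro j _ hj
    by_contra h0
    exact hj (ht i j (left_ne_zero_of_mul h0))
  · simp

lemma entry_ne {t : UG p} {k : ZMod p} (ht : Sh k t) (i : ZMod p) : t.1 i (i + k) ≠ 0 := by
  intro h
  have := diag_ne ht i
  rw [h] at this
  simp at this

/-- A diagonal element commuting with a shift by one up to scalars is scalar times a power of `a`. -/
lemma key {a : UG p} (ha : (a : Matrix (ZMod p) (ZMod p) ℂ) = Amat p) {t s : UG p}
    (ht : Sh 0 t) (hs : Sh 1 s) (H : s * t * (t * s)⁻¹ ∈ scalarSubgroup p) :
    ∃ m : ℕ, t * (a ^ m)⁻¹ ∈ scalarSubgroup p := by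
  obtain ⟨c, hc⟩ := comm_val H
  obtain ⟨f, hf⟩ := mem_T.mpr ht
  have hstep : ∀ i, f (i + 1) = c * f i := by
    intro i
    have h := congrFun (congrFun hc i) (i + 1)
    have h' := entry_ne hs i
    rw [hf, Matrix.mul_diagonal, Matrix.smul_apply, Matrix.diagonal_mul, smul_eq_mul] at h
    apply mul_left_cancel₀ h'
    rw [h]; ring
  have hn : ∀ n : ℕ, f (n : ZMod p) = c ^ n * f 0 := by
    intro n
    induction n with
    | zero => simp
    | succ n ih => push_cast; rw [hstep, ih]; ring
  have hf0 : f 0 ≠ 0 := by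
    have := entry_ne ht 0
    rw [hf] at this
    simpa using this
  have hcp : c ^ p = 1 := by
    have := hn p
    rw [ZMod.natCast_self] at this
    apply mul_right_cancel₀ hf0
    rw [← this, one_mul]
  obtain ⟨m, hm⟩ := ch_surj hcp
  refine ⟨m, scalar_of_smul (c := f 0) ?_⟩
  rw [a_pow ha, hf, ← Matrix.diagonal_smul]
  congr 1
  ext i
  have := hn i.val
  rw [ZMod.natCast_zmod_val] at this
  rw [this, hm, ch_pow, ZMod.natCast_zmod_val, mul_comm i]
  simp [mul_comm]

lemma Gamma_comm {a b : UG p} (ha : (a : Matrix (ZMod p) (ZMod p) ℂ) = Amat p)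
    (hb : (b : Matrix (ZMod p) (ZMod p) ℂ) = Bmat p) {g h : UG p}
    (hg : g ∈ Gamma p a b) (hh : h ∈ Gamma p a b) : g * h * (h * g)⁻¹ ∈ scalarSubgroup p := by
  haveI := scalar_normal (p := p)
  have hab : (QuotientGroup.mk (a * b) : UG p ⧸ scalarSubgroup p) = QuotientGroup.mk (b * a) := by
    rw [QuotientGroup.eq_iff_div_mem, div_eq_mul_inv]
    apply scalar_of_smul (c := ch p (-1))
    rw [Matrix.UnitaryGroup.mul_val, Matrix.UnitaryGroup.mul_val, ha, hb]
    ext i j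
    rw [Amat, Matrix.smul_apply, Matrix.diagonal_mul, Matrix.mul_diagonal]
    by_cases hj : j = i + 1
    · have : ch p i = ch p (-1) * ch p j := by rw [← ch_add, hj]; congr 1; ring
      simpa [Bmat, hj, ch] using this
    · simp [Bmat, hj]
  have hz : ∀ z ∈ scalarSubgroup p, (QuotientGroup.mk z : UG p ⧸ scalarSubgroup p) = 1 := by
    intro z hz
    exact (QuotientGroup.eq_one_iff z).mpr hz
  have main : (QuotientGroup.mk g : UG p ⧸ scalarSubgroup p) * QuotientGroup.mk h
      = QuotientGroup.mk h * QuotientGroup.mk g := by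
    have hab' : (QuotientGroup.mk a : UG p ⧸ scalarSubgroup p) * QuotientGroup.mk b
      = QuotientGroup.mk b * QuotientGroup.mk a := hab
    have gen : ∀ x ∈ ({a, b} ∪ (scalarSubgroup p : Set (UG p))),
        ∀ y ∈ ({a, b} ∪ (scalarSubgroup p : Set (UG p))),
        Commute (QuotientGroup.mk x : UG p ⧸ scalarSubgroup p) (QuotientGroup.mk y) := by
      rintro x ((rfl | rfl) | hx) y ((rfl | rfl) | hy)
      · exact Commute.refl _
      · exact hab'
      · rw [hz _ hy]; exact Commute.one_right _
      · exact hab'.symm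
      · exact Commute.refl _
      · rw [hz _ hy]; exact Commute.one_right _
      · rw [hz _ hx]; exact Commute.one_left _
      · rw [hz _ hx]; exact Commute.one_left _
      · rw [hz _ hx]; exact Commute.one_left _
    have : Commute (QuotientGroup.mk g : UG p ⧸ scalarSubgroup p) (QuotientGroup.mk h) := by
      refine Subgroup.closure_induction (p := fun g _ =>
        Commute (QuotientGroup.mk g : UG p ⧸ scalarSubgroup p) (QuotientGroup.mk h)) ?_ ?_ ?_ ?_ hg
      · intro x hx
        refine Subgroup.closure_induction (p := fun h _ =>
          Commute (QuotientGroup.mk x : UG p ⧸ scalarSubgroup p) (QuotientGroup.mk h)) ?_ ?_ ?_ ?_ hh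
        · exact fun y hy => gen x hx y hy
        · exact Commute.one_right _
        · intro y z _ _ h1 h2; exact h1.mul_right h2
        · intro y _ h1; exact h1.inv_right
      · exact Commute.one_left _
      · intro y z _ _ h1 h2; exact h1.mul_left h2
      · intro y _ h1; exact h1.inv_left
    exact this
  have h2 : (QuotientGroup.mk (g * h) : UG p ⧸ scalarSubgroup p) = QuotientGroup.mk (h * g) := main
  rwa [QuotientGroup.eq_iff_div_mem, div_eq_mul_inv] at h2

lemma mem_Gamma {a b : UG p} (ha : (a : Matrix (ZMod p) (ZMod p) ℂ) = Amat p)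
    (hb : (b : Matrix (ZMod p) (ZMod p) ℂ) = Bmat p) {q : UG p}
    (h1 : q * a * (a * q)⁻¹ ∈ scalarSubgroup p) (h2 : b * q * (q * b)⁻¹ ∈ scalarSubgroup p) :
    q ∈ Gamma p a b := by
  have hbG : b ∈ Gamma p a b := Subgroup.subset_closure (by simp)
  have haG : a ∈ Gamma p a b := Subgroup.subset_closure (by simp)
  have hzG : ∀ z ∈ scalarSubgroup p, z ∈ Gamma p a b :=
    fun z hz => Subgroup.subset_closure (Or.inr hz)
  obtain ⟨c, hc⟩ := comm_val h1
  have hent : ∀ i j, q.1 i j ≠ 0 → ch p j = c * ch p i := by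
    intro i j hij
    have h := congrFun (congrFun hc i) j
    rw [ha, Amat, Matrix.mul_diagonal, Matrix.smul_apply, Matrix.diagonal_mul, smul_eq_mul] at h
    apply mul_left_cancel₀ hij
    change q.1 i j * ch p j = c * (ch p i * q.1 i j) at h
    rw [h]; ring
  obtain ⟨k, hk⟩ : ∃ k, Sh k q := by
    obtain ⟨j₀, hj₀⟩ : ∃ j, q.1 0 j ≠ 0 := by
      by_contra! h0
      have h : (q * q⁻¹).1 0 0 = 1 := by rw [mul_inv_cancel]; simp
      rw [Matrix.UnitaryGroup.mul_val, Matrix.mul_apply] at h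
      simp [h0] at h
    have hcj := hent 0 j₀ hj₀
    rw [ch_zero, mul_one] at hcj
    refine ⟨j₀, fun i j hij => ch_inj ?_⟩
    rw [hent i j hij, ← hcj, ch_add, mul_comm]
  set B := b ^ k.val with hB
  have hBs : Sh k B := by
    have := sh_pow (sh_b hb) k.val
    simpa using this
  have ht : Sh 0 (q * B⁻¹) := by
    have := sh_mul hk (sh_inv hBs)
    simpa using this
  have hcB : b * B = B * b := (Commute.self_pow b _).eq
  have hcB' : B⁻¹ * b = b * B⁻¹ := by
    rw [inv_mul_eq_iff_eq_mul, ← mul_assoc, ← hcB, mul_inv_cancel_right]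
  have : b * (q * B⁻¹) * (q * B⁻¹ * b)⁻¹ = b * q * (q * b)⁻¹ := by
    rw [mul_assoc q, hcB']; group
  obtain ⟨m, hm⟩ := key ha ht (sh_b hb) (by rw [this]; exact h2)
  have : q = (q * B⁻¹ * (a ^ m)⁻¹) * a ^ m * B := by group
  rw [this]
  exact mul_mem (mul_mem (hzG _ hm) (pow_mem haG _)) (pow_mem hbG _)

/-- A shift by one is conjugate by a diagonal matrix to a scalar times `b`. -/
lemma straighten {b : UG p} (hb : (b : Matrix (ZMod p) (ZMod p) ℂ) = Bmat p) {s : UG p}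
    (hs : Sh 1 s) : ∃ e : UG p, e ∈ Tsub p ∧ (e * s * e⁻¹) * b⁻¹ ∈ scalarSubgroup p := by
  have hp : p ≠ 0 := (Fact.out : p.Prime).ne_zero
  set d : ZMod p → ℂ := fun i => s.1 i (i + 1) with hd
  have hdn : ∀ i, ‖d i‖ = 1 := by
    intro i
    have := diag_ne hs i
    have h2 := congrArg norm this
    rw [norm_mul, norm_star, norm_one] at h2
    have h3 := norm_nonneg (d i)
    change ‖d i‖ * ‖d i‖ = 1 at h2
    nlinarith
  set D : ℂ := ∏ n ∈ Finset.range p, d (n : ZMod p) with hD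
  have hDn : ‖D‖ = 1 := by
    rw [hD, norm_prod]
    exact Finset.prod_eq_one fun i _ => hdn _
  obtain ⟨c, hc⟩ : ∃ c : ℂ, c ^ p = D := IsAlgClosed.exists_pow_nat_eq D (Nat.pos_of_ne_zero hp)
  have hcn : ‖c‖ = 1 := by
    have : ‖c‖ ^ p = 1 := by rw [← norm_pow, hc, hDn]
    exact (pow_eq_one_iff_of_nonneg (norm_nonneg c) hp).mp this
  have hc0 : c ≠ 0 := by
    intro h; rw [h] at hcn; simp at hcn
  set E : ℕ → ℂ := fun n => ∏ j ∈ Finset.range n, (d (j : ZMod p) / c) with hE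
  have hEp : E p = 1 := by
    rw [hE]
    simp only [Finset.prod_div_distrib, Finset.prod_const, Finset.card_range]
    rw [← hD, hc]
    apply div_self
    intro h; rw [h] at hDn; simp at hDn
  set f : ZMod p → ℂ := fun i => E i.val with hf
  have hfn : ∀ i, ‖f i‖ = 1 := by
    intro i
    simp only [hf, hE, norm_prod, norm_div, hdn, hcn]
    simp
  have hstep : ∀ i, f (i + 1) * c = f i * d i := by
    intro i
    have h1 : E (i.val + 1) * c = f i * d i := by
      simp only [hE, hf, Finset.prod_range_succ, ZMod.natCast_zmod_val]
      field_simp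
    rw [← h1]
    congr 1
    rcases Nat.lt_or_ge (i.val + 1) p with h | h
    · have : (i + 1) = ((i.val + 1 : ℕ) : ZMod p) := by push_cast; rw [ZMod.natCast_zmod_val]
      simp only [hf]
      rw [this, ZMod.val_natCast_of_lt h]
    · have h2 : i.val + 1 = p := le_antisymm (ZMod.val_lt i) h
      have : (i + 1) = 0 := by
        rw [← ZMod.natCast_zmod_val i, ← Nat.cast_one, ← Nat.cast_add, h2, ZMod.natCast_self]
      simp only [hf]
      rw [this, h2, hEp]
      simp [hE]
  have hu : diagonal f ∈ Matrix.unitaryGroup (ZMod p) ℂ := by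
    rw [Matrix.mem_unitaryGroup_iff, Matrix.star_eq_conjTranspose, Matrix.diagonal_conjTranspose,
      Matrix.diagonal_mul_diagonal, ← Matrix.diagonal_one]
    congr 1
    ext i
    have := Complex.mul_conj' (f i)
    rw [hfn] at this
    simpa using this
  refine ⟨⟨diagonal f, hu⟩, ⟨f, rfl⟩, ?_⟩
  set e : UG p := ⟨diagonal f, hu⟩ with he
  have : e * s * e⁻¹ * b⁻¹ = (e * s) * (b * e)⁻¹ := by group
  rw [this]
  apply scalar_of_smul (c := c)
  rw [Matrix.UnitaryGroup.mul_val, Matrix.UnitaryGroup.mul_val, hb]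
  change diagonal f * s.1 = c • (Bmat p * diagonal f)
  ext i j
  rw [Matrix.diagonal_mul, Matrix.smul_apply, Matrix.mul_diagonal]
  by_cases hj : j = i + 1
  · subst hj
    rw [← hstep i |>.trans rfl]
    simp [Bmat, mul_comm]
  · have : s.1 i j = 0 := by
      by_contra h0
      exact hj (hs i j h0)
    simp [Bmat, hj, this]

lemma not_comm {a b : UG p} (ha : (a : Matrix (ZMod p) (ZMod p) ℂ) = Amat p)
    (hb : (b : Matrix (ZMod p) (ZMod p) ℂ) = Bmat p) : a * b ≠ b * a := by
  intro h
  have h := congrArg Subtype.val h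
  rw [Matrix.UnitaryGroup.mul_val, Matrix.UnitaryGroup.mul_val, ha, hb] at h
  have h := congrFun (congrFun h 0) 1
  rw [Amat, Matrix.diagonal_mul, Matrix.mul_diagonal] at h
  change ch p 0 * _ = _ * ch p 1 at h
  have h' : ch p (0 : ZMod p) = ch p 1 := by simpa [Bmat] using h
  exact zero_ne_one (ch_inj h')

end Stmt17

open Stmt17
theorem stmt17 (p : ℕ) [Fact p.Prime]
    (a b : UG p)
    (ha : (a : Matrix (ZMod p) (ZMod p) ℂ) = Amat p)
    (hb : (b : Matrix (ZMod p) (ZMod p) ℂ) = Bmat p)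
    (P : Subgroup (UG p)) (hPS : P ≤ Sbold p b)
    (u : UG p) (hu : Subgroup.map (MulAut.conj u).toMonoidHom (Gamma p a b) = P) :
    ∃ g : UG p,
      Subgroup.map (MulAut.conj g).toMonoidHom P = Gamma p a b ∧
      Subgroup.map (MulAut.conj g).toMonoidHom (Sbold p b) = Sbold p b := by
  have hbG : b ∈ Gamma p a b := Subgroup.subset_closure (by simp)
  have haG : a ∈ Gamma p a b := Subgroup.subset_closure (by simp)
  have hzG : ∀ z ∈ scalarSubgroup p, z ∈ Gamma p a b :=
    fun z hz => Subgroup.subset_closure (Or.inr hz)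
  -- membership in P
  have hP : ∀ x, x ∈ P ↔ ∃ y ∈ Gamma p a b, u * y * u⁻¹ = x := by
    intro x
    rw [← hu, Subgroup.mem_map]
    rfl
  have hzP : ∀ z ∈ scalarSubgroup p, z ∈ P := by
    intro z hz
    refine (hP z).mpr ⟨z, hzG z hz, ?_⟩
    rw [← scalar_comm hz u, mul_inv_cancel_right]
  have hPc : ∀ g ∈ P, ∀ h ∈ P, g * h * (h * g)⁻¹ ∈ scalarSubgroup p := by
    intro g hg h hh
    obtain ⟨x, hx, rfl⟩ := (hP g).mp hg
    obtain ⟨y, hy, rfl⟩ := (hP h).mp hh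
    have h1 := scalar_normal.conj_mem _ (Gamma_comm ha hb hx hy) u
    convert h1 using 1
    group
  have hPn : ¬ ∀ g ∈ P, ∀ h ∈ P, g * h = h * g := by
    intro H
    have h1 := H _ ((hP _).mpr ⟨a, haG, rfl⟩) _ ((hP _).mpr ⟨b, hbG, rfl⟩)
    apply not_comm ha hb
    have h2 : u * (a * b) * u⁻¹ = u * (b * a) * u⁻¹ := by
      calc _ = u * a * u⁻¹ * (u * b * u⁻¹) := by group
        _ = _ := h1
        _ = _ := by group
    exact mul_left_cancel (mul_right_cancel h2)
  -- an element of shift one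
  obtain ⟨s, hsP, hs⟩ : ∃ s ∈ P, Sh 1 s := by
    obtain ⟨q, hqP, k, hk, hk0⟩ : ∃ q ∈ P, ∃ k, Sh k q ∧ k ≠ 0 := by
      by_contra! H
      apply hPn
      intro g hg h hh
      obtain ⟨k, hk⟩ := S_le hb (hPS hg)
      obtain ⟨l, hl⟩ := S_le hb (hPS hh)
      rw [H g hg k hk] at hk
      rw [H h hh l hl] at hl
      obtain ⟨f, hf⟩ := mem_T.mpr hk
      obtain ⟨f', hf'⟩ := mem_T.mpr hl
      apply Subtype.ext
      rw [Matrix.UnitaryGroup.mul_val, Matrix.UnitaryGroup.mul_val, hf, hf',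
        Matrix.diagonal_mul_diagonal, Matrix.diagonal_mul_diagonal]
      congr 1
      ext i
      exact mul_comm _ _
    refine ⟨q ^ (k⁻¹).val, pow_mem hqP _, ?_⟩
    have := sh_pow hk (k⁻¹).val
    rwa [ZMod.natCast_zmod_val, inv_mul_cancel₀ hk0] at this
  -- a noncentral diagonal element
  obtain ⟨t, htP, ht, htz⟩ : ∃ t ∈ P, Sh 0 t ∧ t ∉ scalarSubgroup p := by
    by_contra! H
    have key2 : ∀ g ∈ P, ∃ z ∈ scalarSubgroup p, ∃ n : ℕ, g = z * s ^ n := by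
      intro g hg
      obtain ⟨k, hk⟩ := S_le hb (hPS hg)
      have h1 : Sh 0 (g * (s ^ k.val)⁻¹) := by
        have := sh_mul hk (sh_inv (sh_pow hs k.val))
        simpa using this
      exact ⟨_, H _ (mul_mem hg (inv_mem (pow_mem hsP _))) h1, k.val, by group⟩
    apply hPn
    intro g hg h hh
    obtain ⟨z, hz, n, rfl⟩ := key2 g hg
    obtain ⟨w, hw, m, rfl⟩ := key2 h hh
    have c1 : Commute z (w * s ^ m) := scalar_comm hz _
    have c2 : Commute (s ^ n) w := (scalar_comm hw _).symm
    have c3 : Commute (s ^ n) (s ^ m) := Commute.pow_pow_self s n m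
    exact (c1.mul_left (c2.mul_right c3)).eq
  have haP : a ∈ P := by
    obtain ⟨m, hm⟩ := key ha ht hs (hPc s hsP t htP)
    have hamP : a ^ m ∈ P := by
      have : a ^ m = (t * (a ^ m)⁻¹)⁻¹ * t := by group
      rw [this]
      exact mul_mem (inv_mem (hzP _ hm)) htP
    have hm0 : (m : ZMod p) ≠ 0 := by
      intro h0
      have : a ^ m = a ^ 0 := a_pow_congr ha (by simpa using h0)
      rw [this] at hm
      simp at hm
      exact htz hm
    have : a = (a ^ m) ^ ((m : ZMod p)⁻¹).val := by
      rw [← pow_mul]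
      conv_lhs => rw [← pow_one a]
      apply a_pow_congr ha
      push_cast
      rw [ZMod.natCast_zmod_val, mul_inv_cancel₀ hm0]
    rw [this]
    exact pow_mem hamP _
  obtain ⟨e, heT, he⟩ := straighten hb hs
  have heS : e ∈ Sbold p b := (le_sup_left : Tsub p ≤ _) heT
  have hQ : ∀ x, x ∈ Subgroup.map (MulAut.conj e).toMonoidHom P ↔ ∃ y ∈ P, e * y * e⁻¹ = x := by
    intro x
    rw [Subgroup.mem_map]
    rfl
  have hzQ : ∀ z ∈ scalarSubgroup p, z ∈ Subgroup.map (MulAut.conj e).toMonoidHom P := by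
    intro z hz
    refine (hQ z).mpr ⟨z, hzP z hz, ?_⟩
    rw [← scalar_comm hz e, mul_inv_cancel_right]
  have haQ : a ∈ Subgroup.map (MulAut.conj e).toMonoidHom P := by
    refine (hQ a).mpr ⟨a, haP, ?_⟩
    rw [mul_inv_eq_iff_eq_mul]
    obtain ⟨f, hf⟩ := heT
    apply Subtype.ext
    rw [Matrix.UnitaryGroup.mul_val, Matrix.UnitaryGroup.mul_val, hf, ha, Amat,
        Matrix.diagonal_mul_diagonal, Matrix.diagonal_mul_diagonal]
    congr 1
    ext i
    exact mul_comm _ _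
  have hbQ : b ∈ Subgroup.map (MulAut.conj e).toMonoidHom P := by
    have : b = (e * s * e⁻¹ * b⁻¹)⁻¹ * (e * s * e⁻¹) := by group
    rw [this]
    exact mul_mem (inv_mem (hzQ _ he)) ((hQ _).mpr ⟨s, hsP, rfl⟩)
  have hQc : ∀ g ∈ Subgroup.map (MulAut.conj e).toMonoidHom P,
      ∀ h ∈ Subgroup.map (MulAut.conj e).toMonoidHom P,
      g * h * (h * g)⁻¹ ∈ scalarSubgroup p := by
    intro g hg h hh
    obtain ⟨x, hx, rfl⟩ := (hQ g).mp hg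
    obtain ⟨y, hy, rfl⟩ := (hQ h).mp hh
    have h1 := scalar_normal.conj_mem _ (hPc x hx y hy) e
    convert h1 using 1
    group
  refine ⟨e, le_antisymm ?_ ?_, ?_⟩
  · intro q hq
    exact mem_Gamma ha hb (hQc q hq a haQ) (hQc b hbQ q hq)
  · rw [Gamma, Subgroup.closure_le]
    rintro x ((rfl | rfl) | hx)
    · exact haQ
    · exact hbQ
    · exact hzQ x hx
  · apply le_antisymm
    · rintro _ ⟨y, hy, rfl⟩
      exact mul_mem (mul_mem heS hy) (inv_mem heS)
    · intro x hx
      refine ⟨e⁻¹ * x * e, mul_mem (mul_mem (inv_mem heS) hx) heS, ?_⟩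
      change e * (e⁻¹ * x * e) * e⁻¹ = x
      group
end
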